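/- arXiv:0811.2103 — 2 statements merged into one kernel-verified Lean document; each statement's English description precedes it below -/
import Mathlib

section
/- Let Ω ⊆ ℝ^D be open, H = a·∇ a C^∞ vector field on Ω with a(x) ≠ 0 for all x ∈ Ω, and Σ a C^∞ hypersurface of Ω that is closed as a subset of Ω. Let μ and ν be N×N matrix-valued Radon measures on Ω, let b, c : Ω → ℂ^{N×N} be C^∞, suppose Hμ + bμ + μc = ν holds in the sense of distributions, that ν is absolutely continuous with respect to μ, and that supp ν ⊆ Σ. Then for every integer k ≥ 0, 1_{Σ(k;H)} μ = 0 and 1_{Σ(k;H)} ν = 0. -/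
noncomputable section
open Topology MeasureTheory


/-- The directional derivative `(Hf)(x) = a(x)·∇f(x)` of `f` along the vector field `a`. -/
def vfDeriv {D : ℕ} (a : (Fin D → ℝ) → (Fin D → ℝ)) (f : (Fin D → ℝ) → ℝ) :
    (Fin D → ℝ) → ℝ :=
  fun x => fderiv ℝ f x (a x)

/-- The iterate `H^k f` of the vector field `H = a·∇` applied to `f`. -/
def vfIter {D : ℕ} (a : (Fin D → ℝ) → (Fin D → ℝ)) :
    ℕ → ((Fin D → ℝ) → ℝ) → ((Fin D → ℝ) → ℝ)
  | 0, f => f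
  | k + 1, f => vfDeriv a (vfIter a k f)

/-- `γ` is a local defining function, on the open set `U ⊆ Ω`, for the hypersurface `S` of `Ω`. -/
def IsLocalDefining {D : ℕ} (Ω S U : Set (Fin D → ℝ)) (γ : (Fin D → ℝ) → ℝ) : Prop :=
  IsOpen U ∧ U ⊆ Ω ∧ ContDiffOn ℝ (⊤ : ℕ∞) γ U ∧ (∀ y ∈ U, fderiv ℝ γ y ≠ 0) ∧
    S ∩ U = {y ∈ U | γ y = 0}

/-- `S` is a `C^∞` hypersurface of the open set `Ω`. -/
def IsHypersurface {D : ℕ} (Ω S : Set (Fin D → ℝ)) : Prop :=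
  S ⊆ Ω ∧ ∀ x ∈ S, ∃ U γ, IsLocalDefining Ω S U γ ∧ x ∈ U

/-- The set `Σ(k;H)` of points of `S` where the vector field `H = a·∇` has contact of
exact order `k` with `S` (for `k = 0`, `H` is transverse to `S`). -/
def contactSet {D : ℕ} (a : (Fin D → ℝ) → (Fin D → ℝ)) (Ω S : Set (Fin D → ℝ)) (k : ℕ) :
    Set (Fin D → ℝ) :=
  {x | x ∈ S ∧ ∃ U γ, IsLocalDefining Ω S U γ ∧ x ∈ U ∧
    (∀ i, 1 ≤ i → i ≤ k → vfIter a i γ x = 0) ∧ vfIter a (k + 1) γ x ≠ 0}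

/-- The set `Σ(∞;H)` of points of `S` where `H = a·∇` is tangent to `S` at infinite order. -/
def contactInf {D : ℕ} (a : (Fin D → ℝ) → (Fin D → ℝ)) (Ω S : Set (Fin D → ℝ)) :
    Set (Fin D → ℝ) :=
  {x | x ∈ S ∧ ∃ U γ, IsLocalDefining Ω S U γ ∧ x ∈ U ∧
    ∀ i, 1 ≤ i → vfIter a i γ x = 0}

/-- The transfinite family `F(α;H;Σ)` of Definition 3.3. -/
def Fset {D : ℕ} (a : (Fin D → ℝ) → (Fin D → ℝ)) (Ω S : Set (Fin D → ℝ)) (α : Ordinal) :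
    Set (Fin D → ℝ) :=
  Ordinal.limitRecOn α (contactInf a Ω S)
    (fun _β Fβ => Fβ \ {x | ∃ U Θ, IsOpen U ∧ x ∈ U ∧ U ⊆ Ω ∧ IsHypersurface U Θ ∧
        Fβ ∩ U ⊆ Θ ∧ ∃ k : ℕ, x ∈ contactSet a U Θ k})
    (fun _α _ IH => ⋂ (β) (h : _), IH β h)

/-- An `N×N` matrix of (locally finite, complex) Radon measures on the open set `Ω ⊆ ℝ^D`.
Each entry `μ_{pq}` is encoded by its polar decomposition: a positive Borel measure
`ρ p q` (the total variation `|μ_{pq}|`), locally finite on `Ω` and carried by `Ω`,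
together with a measurable density `dens p q` of modulus one, so that
`μ_{pq}(B) = ∫_B dens p q ∂(ρ p q)`. -/
structure MatRadonMeasure (D N : ℕ) (Ω : Set (Fin D → ℝ)) where
  ρ : Fin N → Fin N → Measure (Fin D → ℝ)
  dens : Fin N → Fin N → (Fin D → ℝ) → ℂ
  locFin : ∀ p q, ∀ x ∈ Ω, ∃ U, IsOpen U ∧ x ∈ U ∧ ρ p q U < ⊤
  carried : ∀ p q, ρ p q Ωᶜ = 0
  meas_dens : ∀ p q, Measurable (dens p q)
  norm_dens : ∀ p q x, ‖dens p q x‖ = 1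

namespace MatRadonMeasure

variable {D N : ℕ} {Ω : Set (Fin D → ℝ)}

/-- The value `μ_{pq}(B)` of the entry measure on a Borel set `B`. -/
def entry (μ : MatRadonMeasure D N Ω) (p q : Fin N) (B : Set (Fin D → ℝ)) : ℂ :=
  ∫ x in B, μ.dens p q x ∂(μ.ρ p q)

/-- `tr ∫ ψ dμ = Σ_{p,q} ∫ ψ_{qp} dμ_{pq}`. -/
def trInt (μ : MatRadonMeasure D N Ω) (ψ : (Fin D → ℝ) → Fin N → Fin N → ℂ) : ℂ :=
  ∑ p, ∑ q, ∫ x, ψ x q p * μ.dens p q x ∂(μ.ρ p q)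

/-- `1_S μ = 0` : every Borel subset of `S` is null for every entry of `μ`. -/
def VanishesOn (μ : MatRadonMeasure D N Ω) (S : Set (Fin D → ℝ)) : Prop :=
  ∀ p q, ∀ B ⊆ S, MeasurableSet B → μ.entry p q B = 0

/-- The support of `μ` : the complement in `Ω` of the largest open set
on which all entries of `μ` vanish. -/
def support (μ : MatRadonMeasure D N Ω) : Set (Fin D → ℝ) :=
  {x | x ∈ Ω ∧ ∀ V, IsOpen V → x ∈ V → ¬ μ.VanishesOn V}

/-- `ν` is absolutely continuous with respect to `μ` : any Borel set null for `|μ_{pq}|`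
for all `p, q` is also null for `|ν_{pq}|` for all `p, q`. -/
def AC (ν μ : MatRadonMeasure D N Ω) : Prop :=
  ∀ B, MeasurableSet B → (∀ p q, μ.ρ p q B = 0) → ∀ p q, ν.ρ p q B = 0

end MatRadonMeasure

/-- The divergence `div a = Σ_l ∂a_l/∂x_l` of the vector field `a`. -/
def divergence {D : ℕ} (a : (Fin D → ℝ) → (Fin D → ℝ)) (x : Fin D → ℝ) : ℝ :=
  ∑ l, fderiv ℝ (fun y => a y l) x (Pi.single l 1)

/-- The equation `Hμ + bμ + μc = ν` in the sense of distributions on `Ω`, where `H = a·∇`: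
for every smooth compactly supported matrix-valued `φ` with support in `Ω`,
`−tr∫ (a·∇φ + (div a)φ) dμ + tr∫ φb dμ + tr∫ cφ dμ = tr∫ φ dν`. -/
def DistribEq {D N : ℕ} {Ω : Set (Fin D → ℝ)} (a : (Fin D → ℝ) → (Fin D → ℝ))
    (b c : (Fin D → ℝ) → Fin N → Fin N → ℂ) (μ ν : MatRadonMeasure D N Ω) : Prop :=
  ∀ φ : (Fin D → ℝ) → Fin N → Fin N → ℂ,
    ContDiff ℝ (⊤ : ℕ∞) φ → HasCompactSupport φ → tsupport φ ⊆ Ω →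
    - μ.trInt (fun x q p => fderiv ℝ (fun y => φ y q p) x (a x)
          + (divergence a x : ℂ) * φ x q p)
      + μ.trInt (fun x q p => ∑ r, φ x q r * b x r p)
      + μ.trInt (fun x q p => ∑ r, c x q r * φ x r p)
      = ν.trInt φ

open Filter in
/-- Functions vanishing on the zero set of a submersion are dominated by it. -/
theorem fcv_compare {D : ℕ} {f g : (Fin D → ℝ) → ℝ} {y : Fin D → ℝ}
    (hf : ContDiffAt ℝ 1 f y) (hg : ContDiffAt ℝ 1 g y) (hf0 : fderiv ℝ f y ≠ 0)
    (hfy : f y = 0) (hz : ∀ᶠ z in 𝓝 y, f z = 0 → g z = 0) :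
    ∃ C : ℝ, ∀ᶠ z in 𝓝 y, |g z| ≤ C * |f z| := by
  obtain ⟨v0, hv0⟩ : ∃ v, fderiv ℝ f y v ≠ 0 := by
    by_contra! h
    exact hf0 (ContinuousLinearMap.ext h)
  obtain ⟨v, hv⟩ : ∃ v, fderiv ℝ f y v = 1 :=
    ⟨(fderiv ℝ f y v0)⁻¹ • v0, by simp [hv0]⟩
  have hvn : 0 < ‖v‖ := by
    rw [norm_pos_iff]; rintro rfl; simp at hv
  have hfs := hf.hasStrictFDerivAt (by simp)
  have hgs := hg.hasStrictFDerivAt (by simp)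
  obtain ⟨K, s1, hs1, hK⟩ := hgs.exists_lipschitzOnWith
  obtain ⟨s2, hs2, hA⟩ := hfs.approximates_deriv_on_nhds (c := Real.toNNReal (1 / (2 * ‖v‖)))
    (Or.inr (Real.toNNReal_pos.2 (by positivity)))
  obtain ⟨δ, hδ, hball⟩ := Metric.mem_nhds_iff.1 (inter_mem (inter_mem hs1 hs2) hz)
  refine ⟨K * (2 * ‖v‖), ?_⟩
  have hc : Tendsto (fun z => 2 * |f z| * ‖v‖) (𝓝 y) (𝓝 0) := by
    have h1 : Tendsto (fun z => 2 * |f z| * ‖v‖) (𝓝 y) (𝓝 (2 * |f y| * ‖v‖)) :=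
      ((hf.continuousAt.abs.const_mul 2).mul_const _)
    simpa [hfy] using h1
  filter_upwards [Metric.ball_mem_nhds y (half_pos hδ), hc.eventually (gt_mem_nhds (half_pos hδ))]
    with z hz1 hz2
  set s0 := 2 * |f z| with hs0
  have hs0n : 0 ≤ s0 := by positivity
  have hzmem : ∀ s : ℝ, |s| ≤ s0 → z + s • v ∈ Metric.ball y δ := by
    intro s hs
    rw [Metric.mem_ball, dist_eq_norm]
    rw [Metric.mem_ball, dist_eq_norm] at hz1
    calc ‖z + s • v - y‖ = ‖(z - y) + s • v‖ := by congr 1; abel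
      _ ≤ ‖z - y‖ + |s| * ‖v‖ := by
        refine (norm_add_le _ _).trans ?_
        rw [norm_smul, Real.norm_eq_abs]
      _ ≤ ‖z - y‖ + s0 * ‖v‖ := by gcongr
      _ < δ := by linarith
  have hz0 : z ∈ Metric.ball y δ := by simpa using hzmem 0 (by simpa using hs0n)
  have hest : ∀ s : ℝ, |s| ≤ s0 → |f (z + s • v) - f z - s| ≤ |s| / 2 := by
    intro s hs
    have h := hA _ (hball (hzmem s hs)).1.2 _ (hball hz0).1.2
    simp only [add_sub_cancel_left, map_smul, hv, norm_smul, Real.norm_eq_abs, smul_eq_mul,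
      mul_one] at h
    rw [Real.coe_toNNReal _ (by positivity)] at h
    refine h.trans (le_of_eq ?_)
    field_simp
  have hcont : ContinuousOn (fun s : ℝ => f (z + s • v)) (Set.Icc (-s0) s0) := by
    refine hA.continuousOn.comp (by fun_prop) ?_
    intro s hs
    exact (hball (hzmem s (abs_le.2 hs))).1.2
  obtain ⟨s, hs, hs'⟩ : (0 : ℝ) ∈ (fun s : ℝ => f (z + s • v)) '' Set.Icc (-s0) s0 := by
    refine intermediate_value_Icc (by linarith) hcont ⟨?_, ?_⟩
    · have h := (abs_le.1 (hest (-s0) (by rw [abs_neg, abs_of_nonneg hs0n]))).2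
      rw [abs_neg, abs_of_nonneg hs0n] at h
      have := le_abs_self (f z)
      linarith
    · have h := (abs_le.1 (hest s0 (by rw [abs_of_nonneg hs0n]))).1
      rw [abs_of_nonneg hs0n] at h
      have := neg_abs_le (f z)
      linarith
  have hsabs := abs_le.2 hs
  have hg0 : g (z + s • v) = 0 := (hball (hzmem s hsabs)).2 hs'
  have := hK.dist_le_mul z (hball hz0).1.1 (z + s • v) (hball (hzmem s hsabs)).1.1
  rw [hg0, dist_eq_norm, dist_eq_norm, sub_zero, sub_add_cancel_left, norm_neg, norm_smul,
    Real.norm_eq_abs, Real.norm_eq_abs] at this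
  calc |g z| ≤ K * (|s| * ‖v‖) := this
    _ ≤ K * (s0 * ‖v‖) := by gcongr
    _ = _ := by rw [hs0]; ring

theorem fcv_vfIter_succ {D : ℕ} (a : (Fin D → ℝ) → (Fin D → ℝ)) (k : ℕ) (f : (Fin D → ℝ) → ℝ) :
    vfIter a k (vfDeriv a f) = vfIter a (k + 1) f := by
  induction k with
  | zero => rfl
  | succ k ih => simp only [vfIter] at ih ⊢; rw [ih]

theorem fcv_vfDeriv_smooth {D : ℕ} {a : (Fin D → ℝ) → (Fin D → ℝ)} {U : Set (Fin D → ℝ)}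
    (hU : IsOpen U) (ha : ContDiffOn ℝ (⊤ : ℕ∞) a U) {f : (Fin D → ℝ) → ℝ}
    (hf : ContDiffOn ℝ (⊤ : ℕ∞) f U) : ContDiffOn ℝ (⊤ : ℕ∞) (vfDeriv a f) U :=
  (hf.fderiv_of_isOpen hU (by simp)).clm_apply ha

theorem fcv_vfIter_smooth {D : ℕ} {a : (Fin D → ℝ) → (Fin D → ℝ)} {U : Set (Fin D → ℝ)}
    (hU : IsOpen U) (ha : ContDiffOn ℝ (⊤ : ℕ∞) a U) {f : (Fin D → ℝ) → ℝ}
    (hf : ContDiffOn ℝ (⊤ : ℕ∞) f U) (k : ℕ) : ContDiffOn ℝ (⊤ : ℕ∞) (vfIter a k f) U := by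
  induction k with
  | zero => exact hf
  | succ k ih => exact fcv_vfDeriv_smooth hU ha ih

open Filter in
/-- Taylor expansion along an integral curve. -/
theorem fcv_taylor {D : ℕ} {a : (Fin D → ℝ) → (Fin D → ℝ)} {U : Set (Fin D → ℝ)}
    (hU : IsOpen U) (ha : ContDiffOn ℝ (⊤ : ℕ∞) a U) {X : ℝ → (Fin D → ℝ)}
    (hX0 : X 0 ∈ U) (hX : ∀ᶠ t in 𝓝 (0 : ℝ), HasDerivAt X (a (X t)) t) (m : ℕ) :
    ∀ f : (Fin D → ℝ) → ℝ, ContDiffOn ℝ (⊤ : ℕ∞) f U → (∀ i < m, vfIter a i f (X 0) = 0) →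
    Tendsto (fun t => f (X t) / t ^ m) (𝓝[>] 0) (𝓝 (vfIter a m f (X 0) / m.factorial)) := by
  have hXc : ContinuousAt X 0 := hX.self_of_nhds.continuousAt
  have hXU : ∀ᶠ t in 𝓝 (0 : ℝ), X t ∈ U := hXc.eventually (hU.mem_nhds hX0)
  have hfc : ∀ f : (Fin D → ℝ) → ℝ, ContDiffOn ℝ (⊤ : ℕ∞) f U →
      Tendsto (fun t => f (X t)) (𝓝[>] 0) (𝓝 (f (X 0))) := by
    intro f hf
    have : ContinuousAt f (X 0) := (hf.continuousOn).continuousAt (hU.mem_nhds hX0)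
    exact (this.tendsto.comp hXc.tendsto).mono_left nhdsWithin_le_nhds
  induction m with
  | zero =>
    intro f hf _
    simpa [vfIter] using hfc f hf
  | succ m ih =>
    intro f hf h0
    have h1 := ih (vfDeriv a f) (fcv_vfDeriv_smooth hU ha hf) (by
      intro i hi
      rw [fcv_vfIter_succ]
      exact h0 _ (by omega))
    rw [fcv_vfIter_succ] at h1
    have hf0 : f (X 0) = 0 := h0 0 (by omega)
    refine HasDerivAt.lhopital_zero_nhdsGT (f' := fun t => vfDeriv a f (X t))
      (g' := fun t => ((m + 1 : ℕ) : ℝ) * t ^ m) ?_ ?_ ?_ ?_ ?_ ?_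
    · filter_upwards [hX.filter_mono nhdsWithin_le_nhds, hXU.filter_mono nhdsWithin_le_nhds]
        with t ht htU
      have hd : HasFDerivAt f (fderiv ℝ f (X t)) (X t) :=
        ((hf.contDiffAt (hU.mem_nhds htU)).differentiableAt (by simp)).hasFDerivAt
      exact hd.comp_hasDerivAt t ht
    · filter_upwards with t
      simpa using hasDerivAt_pow (m + 1) t
    · filter_upwards [self_mem_nhdsWithin] with t ht
      have ht' : (0 : ℝ) < t := ht
      positivity
    · simpa [hf0] using hfc f hf
    · have : Tendsto (fun t : ℝ => t ^ (m + 1)) (𝓝 0) (𝓝 (0 ^ (m + 1))) :=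
        (continuous_pow (m + 1)).tendsto 0
      simpa using this.mono_left nhdsWithin_le_nhds
    · have h2 := h1.div_const ((m + 1 : ℕ) : ℝ)
      have e : vfIter a (m + 1) f (X 0) / (m + 1).factorial
          = vfIter a (m + 1) f (X 0) / m.factorial / ((m + 1 : ℕ) : ℝ) := by
        rw [Nat.factorial_succ, div_div]; push_cast; ring
      rw [e]
      refine h2.congr fun t => ?_
      rw [div_div]; ring

open Filter in
/-- Finite order contact does not depend on the defining function (weak form). -/
theorem fcv_contact {D : ℕ} {a : (Fin D → ℝ) → (Fin D → ℝ)} {Ω S U : Set (Fin D → ℝ)}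
    (ha : ContDiffOn ℝ (⊤ : ℕ∞) a Ω) {γ : (Fin D → ℝ) → ℝ} (hγ : IsLocalDefining Ω S U γ)
    {k : ℕ} {y : Fin D → ℝ} (hy : y ∈ contactSet a Ω S k) (hyU : y ∈ U) :
    ∃ j, vfIter a j γ y = 0 ∧ vfIter a (j + 1) γ y ≠ 0 := by
  obtain ⟨hyS, U', γ', hγ', hyU', h0, h1⟩ := hy
  obtain ⟨hUo, hUΩ, hsm, hgr, hzero⟩ := hγ
  obtain ⟨hUo', hUΩ', hsm', hgr', hzero'⟩ := hγ'
  have hγy : γ y = 0 := (hzero ▸ (⟨hyS, hyU⟩ : y ∈ S ∩ U) : y ∈ {y ∈ U | γ y = 0}).2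
  have hγy' : γ' y = 0 := (hzero' ▸ (⟨hyS, hyU'⟩ : y ∈ S ∩ U') : y ∈ {y ∈ U' | γ' y = 0}).2
  by_contra! hcon
  have hall : ∀ j, vfIter a j γ y = 0 := by
    intro j
    induction j with
    | zero => exact hγy
    | succ j ih => exact hcon j ih
  obtain ⟨C, hC⟩ := fcv_compare (f := γ) (g := γ') (y := y)
    ((hsm.contDiffAt (hUo.mem_nhds hyU)).of_le (by simp))
    ((hsm'.contDiffAt (hUo'.mem_nhds hyU')).of_le (by simp)) (hgr y hyU) hγy (by
      filter_upwards [hUo.mem_nhds hyU, hUo'.mem_nhds hyU'] with z hz hz' hz0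
      have : z ∈ S ∩ U := by rw [hzero]; exact ⟨hz, hz0⟩
      have h2 : z ∈ S ∩ U' := ⟨this.1, hz'⟩
      rw [hzero'] at h2
      exact h2.2)
  have haU := ha.mono hUΩ
  have haU' := ha.mono hUΩ'
  obtain ⟨X, hX0, ε, hε, hX⟩ :=
    ContDiffAt.exists_forall_mem_closedBall_exists_eq_forall_mem_Ioo_hasDerivAt₀
      ((haU.contDiffAt (hUo.mem_nhds hyU)).of_le (by simp)) 0
  have hX' : ∀ᶠ t in 𝓝 (0 : ℝ), HasDerivAt X (a (X t)) t := by
    filter_upwards [Ioo_mem_nhds (show (0 : ℝ) - ε < 0 by linarith) (show 0 < 0 + ε by linarith)]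
      with t ht using hX t ht
  have hXc : Tendsto X (𝓝[>] 0) (𝓝 y) := by
    have := hX'.self_of_nhds.continuousAt.tendsto
    rw [hX0] at this
    exact this.mono_left nhdsWithin_le_nhds
  have t1 := fcv_taylor hUo haU (by rwa [hX0]) hX' (k + 1) γ hsm (by
    intro i _; rw [hX0]; exact hall i)
  have t2 := fcv_taylor hUo' haU' (by rwa [hX0]) hX' (k + 1) γ' hsm' (by
    intro i hi; rw [hX0]
    rcases Nat.eq_zero_or_pos i with rfl | hi0
    · exact hγy'
    · exact h0 i hi0 (by omega))
  rw [hX0] at t1 t2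
  rw [hall, zero_div] at t1
  have t3 : Tendsto (fun t => γ' (X t) / t ^ (k + 1)) (𝓝[>] 0) (𝓝 0) := by
    have t4 := t1.abs.const_mul C
    rw [abs_zero, mul_zero] at t4
    refine squeeze_zero_norm' ?_ t4
    filter_upwards [hXc.eventually hC] with t ht
    rw [Real.norm_eq_abs, abs_div, abs_div, ← mul_div_assoc]
    gcongr
  have := tendsto_nhds_unique t2 t3
  rw [div_eq_zero_iff] at this
  rcases this with h | h
  · exact h1 h
  · exact (Nat.cast_ne_zero.2 (Nat.factorial_ne_zero _)) h

theorem fcv_compact {D N : ℕ} {Ω : Set (Fin D → ℝ)} (μ : MatRadonMeasure D N Ω) (p q : Fin N)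
    {K : Set (Fin D → ℝ)} (hK : IsCompact K) (hKΩ : K ⊆ Ω) : μ.ρ p q K < ⊤ := by
  refine hK.measure_lt_top_of_nhdsWithin fun x hx => ?_
  obtain ⟨U, hU, hxU, hlt⟩ := μ.locFin p q x (hKΩ hx)
  exact ⟨U, mem_nhdsWithin_of_mem_nhds (hU.mem_nhds hxU), hlt⟩

theorem fcv_meas {D : ℕ} {V : Set (Fin D → ℝ)} (hV : IsOpen V) {F : (Fin D → ℝ) → ℂ}
    (hF : ContinuousOn F V) (h0 : ∀ x, x ∉ V → F x = 0) : Measurable F := by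
  classical
  have h := ContinuousOn.measurable_piecewise (f := F) (g := fun _ => (0 : ℂ)) hF
    continuousOn_const hV.measurableSet
  convert h using 1
  ext1 x
  by_cases hx : x ∈ V
  · simp [hx]
  · simp [hx, h0 x hx]

open Filter in
theorem fcv_v_tendsto (y : ℝ) : Tendsto (fun n : ℕ => (1 / (1 + (((n : ℝ) + 1) * y) ^ 2) : ℝ))
    atTop (𝓝 (if y = 0 then 1 else 0)) := by
  split_ifs with hy
  · simp [hy]
  · have h1 : Tendsto (fun n : ℕ => (n : ℝ) + 1) atTop atTop :=
      tendsto_atTop_add_const_right _ _ tendsto_natCast_atTop_atTop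
    have h2 : Tendsto (fun n : ℕ => 1 + (((n : ℝ) + 1) * y) ^ 2) atTop atTop := by
      refine tendsto_atTop_add_const_left _ _ ?_
      simp_rw [mul_pow]
      exact ((tendsto_pow_atTop (by norm_num)).comp h1).atTop_mul_const (by positivity)
    simp only [one_div]
    exact h2.inv_tendsto_atTop

theorem fcv_arctan_bound (y : ℝ) : |Real.arctan y| ≤ 2 := by
  have h1 := Real.arctan_lt_pi_div_two y
  have h2 := Real.neg_pi_div_two_lt_arctan y
  have h3 := Real.pi_le_four
  rw [abs_le]; constructor <;> linarith

theorem fcv_w_bound (n : ℕ) (y : ℝ) :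
    |Real.arctan (((n : ℝ) + 1) * y) / ((n : ℝ) + 1)| ≤ 2 / ((n : ℝ) + 1) := by
  rw [abs_div, abs_of_pos (show (0 : ℝ) < (n : ℝ) + 1 by positivity)]
  gcongr
  exact fcv_arctan_bound _

open Filter in
theorem fcv_w_tendsto (y : ℝ) :
    Tendsto (fun n : ℕ => (Real.arctan (((n : ℝ) + 1) * y) / ((n : ℝ) + 1) : ℝ))
    atTop (𝓝 0) := by
  refine squeeze_zero_norm (a := fun n : ℕ => 2 * (1 / ((n : ℝ) + 1))) (fun n => ?_) ?_
  · rw [Real.norm_eq_abs, mul_one_div]; exact fcv_w_bound n y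
  · simpa using tendsto_one_div_add_atTop_nhds_zero_nat.const_mul (2 : ℝ)

open Filter in
theorem fcv_lim {D N : ℕ} {Ω V K : Set (Fin D → ℝ)} (μ : MatRadonMeasure D N Ω) (hV : IsOpen V)
    (hVΩ : V ⊆ Ω) (hK : IsCompact K) (hKV : K ⊆ V) {f : (Fin D → ℝ) → ℝ}
    (hf : ContinuousOn f V) {W W' : (Fin D → ℝ) → Fin N → Fin N → ℂ}
    (hW : ∀ q p, ContinuousOn (fun x => W x q p) V) (hW0 : ∀ x, x ∉ K → ∀ q p, W x q p = 0)
    (hW' : ∀ q p, ContinuousOn (fun x => W' x q p) V) (hW0' : ∀ x, x ∉ K → ∀ q p, W' x q p = 0) :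
    Tendsto (fun n : ℕ => μ.trInt (fun x q p =>
      ((1 / (1 + (((n : ℝ) + 1) * f x) ^ 2) : ℝ) : ℂ) * W x q p
      + ((Real.arctan (((n : ℝ) + 1) * f x) / ((n : ℝ) + 1) : ℝ) : ℂ) * W' x q p)) atTop
      (𝓝 (μ.trInt (fun x q p => ((if f x = 0 then 1 else 0 : ℝ) : ℂ) * W x q p))) := by
  unfold MatRadonMeasure.trInt
  refine tendsto_finsetSum _ fun p _ => tendsto_finsetSum _ fun q _ => ?_
  obtain ⟨C, hC⟩ := hK.exists_bound_of_continuousOn ((hW q p).mono hKV)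
  obtain ⟨C', hC'⟩ := hK.exists_bound_of_continuousOn ((hW' q p).mono hKV)
  refine tendsto_integral_of_dominated_convergence (K.indicator fun _ => C + 2 * C') ?_ ?_ ?_ ?_
  · intro n
    refine (Measurable.mul ?_ (μ.meas_dens p q)).aestronglyMeasurable
    refine fcv_meas hV ?_ ?_
    · refine ContinuousOn.add (ContinuousOn.mul ?_ (hW q p)) (ContinuousOn.mul ?_ (hW' q p))
      · refine Complex.continuous_ofReal.comp_continuousOn ?_
        refine ContinuousOn.div continuousOn_const (by fun_prop) (fun x _ => by positivity)
      · refine Complex.continuous_ofReal.comp_continuousOn ?_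
        exact (Real.continuous_arctan.comp_continuousOn (continuousOn_const.mul hf)).div_const _
    · intro x hx
      have hxK : x ∉ K := fun h => hx (hKV h)
      simp [hW0 x hxK, hW0' x hxK]
  · exact (integrable_indicator_iff hK.measurableSet).2
      (integrableOn_const (fcv_compact μ p q hK (hKV.trans hVΩ)).ne)
  · intro n
    refine Eventually.of_forall fun x => ?_
    rw [norm_mul, μ.norm_dens, mul_one]
    by_cases hx : x ∈ K
    · rw [Set.indicator_of_mem hx]
      refine (norm_add_le _ _).trans ?_
      rw [norm_mul, norm_mul, Complex.norm_real, Complex.norm_real, Real.norm_eq_abs,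
        Real.norm_eq_abs]
      have h1 : |1 / (1 + (((n : ℝ) + 1) * f x) ^ 2)| ≤ 1 := by
        rw [abs_of_nonneg (by positivity)]
        exact div_le_one_of_le₀ (by nlinarith [sq_nonneg (((n : ℝ) + 1) * f x)]) (by positivity)
      have h2 := fcv_w_bound n (f x)
      have h3 : 2 / ((n : ℝ) + 1) ≤ 2 :=
        div_le_self (by norm_num) (by linarith [Nat.cast_nonneg (α := ℝ) n])
      have h4 := hC x hx
      have h5 := hC' x hx
      have h6 := mul_le_mul h1 h4 (norm_nonneg _) zero_le_one
      have h7 := mul_le_mul (h2.trans h3) h5 (norm_nonneg _) zero_le_two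
      linarith
    · simp [Set.indicator_of_notMem hx, hW0 x hx, hW0' x hx]
  · refine Eventually.of_forall fun x => ?_
    refine Tendsto.mul_const _ ?_
    have t1 := ((Complex.continuous_ofReal.tendsto _).comp (fcv_v_tendsto (f x))).mul_const
      (W x q p)
    have t2 := ((Complex.continuous_ofReal.tendsto _).comp (fcv_w_tendsto (f x))).mul_const
      (W' x q p)
    simpa using t1.add t2

open Filter in
theorem fcv_null {D N : ℕ} {Ω V : Set (Fin D → ℝ)} (hΩ : IsOpen Ω)
    {a : (Fin D → ℝ) → (Fin D → ℝ)} (ha : ContDiffOn ℝ (⊤ : ℕ∞) a Ω)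
    {b c : (Fin D → ℝ) → Fin N → Fin N → ℂ}
    (hb : ContDiffOn ℝ (⊤ : ℕ∞) b Ω) (hc : ContDiffOn ℝ (⊤ : ℕ∞) c Ω)
    {μ ν : MatRadonMeasure D N Ω} (heq : DistribEq a b c μ ν)
    (hV : IsOpen V) (hVΩ : V ⊆ Ω) {f : (Fin D → ℝ) → ℝ} (hf : ContDiffOn ℝ (⊤ : ℕ∞) f V)
    (p0 q0 : Fin N) :
    μ.ρ p0 q0 {x | x ∈ V ∧ f x = 0 ∧ vfDeriv a f x ≠ 0} = 0 := by
  classical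
  have hHf : ContinuousOn (vfDeriv a f) V :=
    (fcv_vfDeriv_smooth hV (ha.mono hVΩ) hf).continuousOn
  -- the key identity
  have key : ∀ ψ : (Fin D → ℝ) → ℝ, ContDiff ℝ (⊤ : ℕ∞) ψ → HasCompactSupport ψ →
      tsupport ψ ⊆ V →
      ∫ x, (((if f x = 0 then 1 else 0 : ℝ) : ℂ) * ((ψ x * vfDeriv a f x : ℝ) : ℂ))
        * μ.dens p0 q0 x ∂(μ.ρ p0 q0) = 0 := by
    intro ψ hψ hψc hψV
    have hψ0 : ∀ x, x ∉ tsupport ψ → ψ x = 0 := fun x hx => image_eq_zero_of_notMem_tsupport hx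
    have hdψ0 : ∀ x, x ∉ tsupport ψ → fderiv ℝ ψ x = 0 := fun x hx =>
      image_eq_zero_of_notMem_tsupport (fun h => hx (tsupport_fderiv_subset ℝ h))
    set E : Fin N → Fin N → ℂ := fun q p => if q = q0 ∧ p = p0 then 1 else 0 with hE
    set w : ℕ → (Fin D → ℝ) → ℝ :=
      fun n x => Real.arctan (((n : ℝ) + 1) * f x) / ((n : ℝ) + 1) with hw
    set g : ℕ → (Fin D → ℝ) → ℝ := fun n x => w n x * ψ x with hg
    have hwsm : ∀ n, ContDiffOn ℝ (⊤ : ℕ∞) (w n) V := fun n =>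
      ((contDiffOn_const.mul hf).arctan).div_const _
    have hts : ∀ n, tsupport (g n) ⊆ tsupport ψ := fun n =>
      closure_mono (Function.support_mul_subset_right _ _)
    have hgsm : ∀ n, ContDiff ℝ (⊤ : ℕ∞) (g n) := by
      intro n
      refine contDiff_iff_contDiffAt.2 fun x => ?_
      by_cases hx : x ∈ tsupport (g n)
      swap
      · exact contDiffAt_const.congr_of_eventuallyEq (notMem_tsupport_iff_eventuallyEq.1 hx)
      have hxV := hψV (hts n hx)
      exact ((hwsm n).contDiffAt (hV.mem_nhds hxV)).mul hψ.contDiffAt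
    set φ : ℕ → (Fin D → ℝ) → Fin N → Fin N → ℂ := fun n x q p => (g n x : ℂ) * E q p with hφ
    have hφsm : ∀ n, ContDiff ℝ (⊤ : ℕ∞) (φ n) := by
      intro n
      refine contDiff_pi.2 fun q => contDiff_pi.2 fun p => ?_
      exact (Complex.ofRealCLM.contDiff.comp (hgsm n)).mul contDiff_const
    have hφts : ∀ n, tsupport (φ n) ⊆ tsupport ψ := by
      intro n
      refine closure_mono fun x hx => ?_
      contrapose! hx
      have : ψ x = 0 := by simpa using hx
      simp only [Function.mem_support, not_not, hφ, hg, this]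
      ext q p; simp
    have hφc : ∀ n, HasCompactSupport (φ n) := fun n =>
      hψc.isCompact.of_isClosed_subset (isClosed_tsupport _) (hφts n)
    have hdg : ∀ n x, fderiv ℝ (g n) x (a x) =
        (1 / (1 + (((n : ℝ) + 1) * f x) ^ 2)) * (ψ x * vfDeriv a f x)
          + w n x * fderiv ℝ ψ x (a x) := by
      intro n x
      by_cases hx : x ∈ tsupport ψ
      · have hxV := hψV hx
        have h1 : HasFDerivAt f (fderiv ℝ f x) x :=
          ((hf.contDiffAt (hV.mem_nhds hxV)).differentiableAt (by simp)).hasFDerivAt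
        have h2 : HasFDerivAt ψ (fderiv ℝ ψ x) x :=
          (hψ.contDiffAt.differentiableAt (by simp)).hasFDerivAt
        have h3 := ((h1.const_mul ((n : ℝ) + 1)).arctan.mul_const ((n : ℝ) + 1)⁻¹).mul h2
        have h4 : g n = (fun y => Real.arctan (((n : ℝ) + 1) * f y) * ((n : ℝ) + 1)⁻¹) * ψ := by
          funext y
          simp only [hg, hw, div_eq_mul_inv, Pi.mul_apply]
        rw [h4, h3.fderiv]
        have hn : (n : ℝ) + 1 ≠ 0 := by positivity
        have hn' : 1 + (((n : ℝ) + 1) * f x) ^ 2 ≠ 0 := by positivity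
        simp only [hw, vfDeriv, ContinuousLinearMap.add_apply, ContinuousLinearMap.smul_apply,
          smul_eq_mul]
        field_simp
        ring
      · have h1 : fderiv ℝ (g n) x = 0 :=
          image_eq_zero_of_notMem_tsupport (fun h => hx (hts n (tsupport_fderiv_subset ℝ h)))
        rw [h1, hψ0 x hx, hdψ0 x hx]
        simp
    have hdφ : ∀ n x q p, fderiv ℝ (fun y => φ n y q p) x (a x) =
        ((fderiv ℝ (g n) x (a x) : ℝ) : ℂ) * E q p := by
      intro n x q p
      have h1 : HasFDerivAt (g n) (fderiv ℝ (g n) x) x :=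
        ((hgsm n).contDiffAt.differentiableAt (by simp)).hasFDerivAt
      have h2 := (Complex.ofRealCLM.hasFDerivAt.comp x h1).mul_const (E q p)
      have h3 : HasFDerivAt (fun y => φ n y q p) _ x := h2
      rw [h3.fderiv]
      simp [mul_comm]
    -- continuity facts
    have haV : ContinuousOn a V := ha.continuousOn.mono hVΩ
    have hdiv : ContinuousOn (divergence a) V := by
      unfold divergence
      refine continuousOn_finsetSum _ fun l _ => ?_
      have h1 : ContDiffOn ℝ (⊤ : ℕ∞) (fun y => a y l) Ω := contDiffOn_pi.1 ha l
      exact (((h1.fderiv_of_isOpen (m := (⊤ : ℕ∞)) hΩ (by simp)).continuousOn).mono hVΩ).clm_apply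
        continuousOn_const
    have hψcont : ContinuousOn ψ V := hψ.continuous.continuousOn
    have hdψcont : ContinuousOn (fun x => fderiv ℝ ψ x (a x)) V :=
      ((hψ.continuous_fderiv (by simp)).continuousOn).clm_apply haV
    have hbV : ∀ r p, ContinuousOn (fun x => b x r p) V := fun r p =>
      (continuousOn_pi.1 (continuousOn_pi.1 hb.continuousOn r) p).mono hVΩ
    have hcV : ∀ r p, ContinuousOn (fun x => c x r p) V := fun r p =>
      (continuousOn_pi.1 (continuousOn_pi.1 hc.continuousOn r) p).mono hVΩ
    have hR : ∀ {u : (Fin D → ℝ) → ℝ}, ContinuousOn u V → ContinuousOn (fun x => (u x : ℂ)) V :=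
      fun hu => Complex.continuous_ofReal.comp_continuousOn hu
    -- the four limits
    have L1 := fcv_lim μ hV hVΩ hψc.isCompact hψV hf.continuousOn
      (W := fun x q p => ((ψ x * vfDeriv a f x : ℝ) : ℂ) * E q p)
      (W' := fun x q p => ((fderiv ℝ ψ x (a x) + divergence a x * ψ x : ℝ) : ℂ) * E q p)
      (fun q p => (hR (hψcont.mul hHf)).mul continuousOn_const)
      (fun x hx q p => by simp [hψ0 x hx])
      (fun q p => (hR (hdψcont.add (hdiv.mul hψcont))).mul continuousOn_const)
      (fun x hx q p => by simp [hψ0 x hx, hdψ0 x hx])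
    have L2 := fcv_lim μ hV hVΩ hψc.isCompact hψV hf.continuousOn
      (W := fun x q p => 0)
      (W' := fun x q p => (ψ x : ℂ) * ∑ r, E q r * b x r p)
      (fun q p => continuousOn_const) (fun x hx q p => rfl)
      (fun q p => (hR hψcont).mul (continuousOn_finsetSum _ fun r _ =>
        continuousOn_const.mul (hbV r p)))
      (fun x hx q p => by simp [hψ0 x hx])
    have L3 := fcv_lim μ hV hVΩ hψc.isCompact hψV hf.continuousOn
      (W := fun x q p => 0)
      (W' := fun x q p => (ψ x : ℂ) * ∑ r, c x q r * E r p)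
      (fun q p => continuousOn_const) (fun x hx q p => rfl)
      (fun q p => (hR hψcont).mul (continuousOn_finsetSum _ fun r _ =>
        (hcV q r).mul continuousOn_const))
      (fun x hx q p => by simp [hψ0 x hx])
    have L4 := fcv_lim ν hV hVΩ hψc.isCompact hψV hf.continuousOn
      (W := fun x q p => 0)
      (W' := fun x q p => (ψ x : ℂ) * E q p)
      (fun q p => continuousOn_const) (fun x hx q p => rfl)
      (fun q p => (hR hψcont).mul continuousOn_const)
      (fun x hx q p => by simp [hψ0 x hx])
    have L := (L1.neg.add L2).add L3
    have hlim := tendsto_nhds_unique (L.congr fun n => ?_) L4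
    · simp only [mul_zero, MatRadonMeasure.trInt, zero_mul, integral_zero,
        Finset.sum_const_zero, add_zero, neg_eq_zero] at hlim
      rw [Finset.sum_eq_single p0, Finset.sum_eq_single q0] at hlim
      · simpa [hE] using hlim
      · intro q _ hq
        simp [hE, hq]
      · simp
      · intro p _ hp
        simp [hE, hp]
      · simp
    · have e := heq (φ n) (hφsm n) (hφc n) ((hφts n).trans (hψV.trans hVΩ))
      convert e using 1
      · congr 1
        · congr 1
          · congr 2
            funext x q p
            rw [hdφ, hdg]
            simp only [hφ, hg, hw]
            push_cast
            ring
          · congr 1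
            funext x q p
            simp only [hφ, hg, hw, Finset.mul_sum, mul_zero, zero_add]
            refine Finset.sum_congr rfl fun r _ => ?_
            push_cast
            ring
        · congr 1
          funext x q p
          simp only [hφ, hg, hw, Finset.mul_sum, mul_zero, zero_add]
          refine Finset.sum_congr rfl fun r _ => ?_
          push_cast
          ring
      · congr 1
        funext x q p
        simp only [hφ, hg, hw, mul_zero, zero_add]
        push_cast
        ring
  -- conclusion
  have hZ : MeasurableSet {x | x ∈ V ∧ f x = 0} := by
    have h1 := fcv_meas hV (F := V.indicator fun x => (f x : ℂ))
      ((Complex.continuous_ofReal.comp_continuousOn hf.continuousOn).congr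
        fun x hx => Set.indicator_of_mem hx _)
      (fun x hx => Set.indicator_of_notMem hx _)
    have h2 := hV.measurableSet.inter (h1 (measurableSet_singleton 0))
    convert h2 using 1
    ext x
    constructor
    · rintro ⟨hx, hx0⟩
      refine ⟨hx, ?_⟩
      simp [hx, hx0]
    · rintro ⟨hx, hx0⟩
      refine ⟨hx, ?_⟩
      simpa [hx] using hx0
  set h : (Fin D → ℝ) → ℂ := fun x =>
    ({x | x ∈ V ∧ f x = 0}.indicator (V.indicator fun x => (vfDeriv a f x : ℂ)) x)
      * μ.dens p0 q0 x with hh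
  have hmeas : Measurable h := by
    refine Measurable.mul (Measurable.indicator ?_ hZ) (μ.meas_dens p0 q0)
    exact fcv_meas hV
      ((Complex.continuous_ofReal.comp_continuousOn hHf).congr
        fun x hx => Set.indicator_of_mem hx _)
      (fun x hx => Set.indicator_of_notMem hx _)
  have hloc : LocallyIntegrableOn h V (μ.ρ p0 q0) := by
    intro x hx
    obtain ⟨K, hK, hxK, hKV⟩ := exists_compact_subset hV hx
    refine ⟨K, mem_nhdsWithin_of_mem_nhds (mem_interior_iff_mem_nhds.1 hxK), ?_⟩
    obtain ⟨C, hC⟩ := hK.exists_bound_of_continuousOn (hHf.mono hKV)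
    refine Measure.integrableOn_of_bounded (M := C) (fcv_compact μ p0 q0 hK (hKV.trans hVΩ)).ne
      hmeas.aestronglyMeasurable ?_
    refine (ae_restrict_iff' hK.measurableSet).2 (Eventually.of_forall fun y hy => ?_)
    rw [hh]
    simp only
    rw [norm_mul, μ.norm_dens, mul_one]
    refine (norm_indicator_le_norm_self _ _).trans ((norm_indicator_le_norm_self _ _).trans ?_)
    rw [Complex.norm_real]
    exact hC y hy
  have hae := hV.ae_eq_zero_of_integral_contDiff_smul_eq_zero hloc (by
    intro ψ hψ hψc hψV
    rw [← key ψ hψ hψc hψV]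
    refine integral_congr_ae (Eventually.of_forall fun x => ?_)
    simp only [hh]
    by_cases hx : x ∈ V
    · by_cases hx0 : f x = 0
      · simp [hx, hx0, mul_assoc]
      · simp [hx0]
    · have : ψ x = 0 := image_eq_zero_of_notMem_tsupport (fun h => hx (hψV h))
      simp [this])
  refine measure_mono_null ?_ (ae_iff.1 hae)
  rintro x ⟨hx, hx0, hx1⟩ hcon
  have h1 := hcon hx
  have h2 : μ.dens p0 q0 x ≠ 0 := by
    rw [← norm_ne_zero_iff, μ.norm_dens]; exact one_ne_zero
  simp only [hh, mul_eq_zero, h2, or_false] at h1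
  rw [Set.indicator_of_mem (show x ∈ {x | x ∈ V ∧ f x = 0} from ⟨hx, hx0⟩),
    Set.indicator_of_mem hx] at h1
  exact hx1 (by exact_mod_cast h1)

/-- Lemma 3.6 of the paper: under the hypotheses of Lemma 3.5,
for every `k ≥ 0`, `1_{Σ(k;H)} μ = 0` and `1_{Σ(k;H)} ν = 0`. -/
theorem finite_contact_vanishing
    {D N : ℕ} (hD : 1 ≤ D) (Ω S : Set (Fin D → ℝ)) (hΩ : IsOpen Ω)
    (a : (Fin D → ℝ) → (Fin D → ℝ)) (ha : ContDiffOn ℝ (⊤ : ℕ∞) a Ω)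
    (ha0 : ∀ x ∈ Ω, a x ≠ 0)
    (hS : IsHypersurface Ω S) (hScl : closure S ∩ Ω ⊆ S)
    (b c : (Fin D → ℝ) → Fin N → Fin N → ℂ)
    (hb : ContDiffOn ℝ (⊤ : ℕ∞) b Ω) (hc : ContDiffOn ℝ (⊤ : ℕ∞) c Ω)
    (μ ν : MatRadonMeasure D N Ω)
    (heq : DistribEq a b c μ ν)
    (hac : ν.AC μ)
    (hsupp : ν.support ⊆ S) :
    ∀ k : ℕ, μ.VanishesOn (contactSet a Ω S k) ∧ ν.VanishesOn (contactSet a Ω S k) := by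
  intro k
  have hnull : ∀ p q, μ.ρ p q (contactSet a Ω S k) = 0 := by
    intro p q
    refine measure_null_of_locally_null _ fun x hx => ?_
    obtain ⟨U, γ, hγ, hxU⟩ := hS.2 x hx.1
    refine ⟨contactSet a Ω S k ∩ U, inter_mem_nhdsWithin _ (hγ.1.mem_nhds hxU), ?_⟩
    refine measure_mono_null (t := ⋃ j : ℕ,
      {x | x ∈ U ∧ vfIter a j γ x = 0 ∧ vfDeriv a (vfIter a j γ) x ≠ 0}) ?_ ?_
    · rintro y ⟨hy, hyU⟩
      obtain ⟨j, hj0, hj1⟩ := fcv_contact ha hγ hy hyU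
      exact Set.mem_iUnion.2 ⟨j, hyU, hj0, hj1⟩
    · refine measure_iUnion_null fun j => ?_
      exact fcv_null hΩ ha hb hc heq hγ.1 hγ.2.1
        (fcv_vfIter_smooth hγ.1 (ha.mono hγ.2.1) hγ.2.2.1 j) p q
  have hμB : ∀ B ⊆ contactSet a Ω S k, ∀ p q, μ.ρ p q B = 0 := fun B hB p q =>
    measure_mono_null hB (hnull p q)
  refine ⟨fun p q B hB _ => ?_, fun p q B hB hBm => ?_⟩
  · exact setIntegral_measure_zero _ (hμB B hB p q)
  · exact setIntegral_measure_zero _ (hac B hBm (hμB B hB) p q)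
end
end

section
/- Let Ω ⊆ ℝ^D be open, H = a·∇ a C^∞ vector field on Ω with a(x) ≠ 0 for all x ∈ Ω, and Σ a C^∞ hypersurface of Ω closed in Ω. If the set Σ(∞;H) is finite or countable, then there exists an ordinal α such that F(α;H;Σ) = ∅. -/
noncomputable section
open Topology MeasureTheory


/-- Smoothness of `Hf`. -/
theorem vfDeriv_smooth {D : ℕ} {a : (Fin D → ℝ) → (Fin D → ℝ)} {W : Set (Fin D → ℝ)}
    (hW : IsOpen W) (ha : ContDiffOn ℝ (⊤ : ℕ∞) a W) {f : (Fin D → ℝ) → ℝ}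
    (hf : ContDiffOn ℝ (⊤ : ℕ∞) f W) : ContDiffOn ℝ (⊤ : ℕ∞) (vfDeriv a f) W := by
  have h1 : ContDiffOn ℝ (⊤ : ℕ∞) (fderiv ℝ f) W := hf.fderiv_of_isOpen hW (by simp)
  exact h1.clm_apply ha

theorem vfIter_smooth {D : ℕ} {a : (Fin D → ℝ) → (Fin D → ℝ)} {W : Set (Fin D → ℝ)}
    (hW : IsOpen W) (ha : ContDiffOn ℝ (⊤ : ℕ∞) a W) {f : (Fin D → ℝ) → ℝ}
    (hf : ContDiffOn ℝ (⊤ : ℕ∞) f W) (k : ℕ) :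
    ContDiffOn ℝ (⊤ : ℕ∞) (vfIter a k f) W := by
  induction k with
  | zero => exact hf
  | succ k ih => exact vfDeriv_smooth hW ha ih

theorem smooth_diffAt {D : ℕ} {W : Set (Fin D → ℝ)}
    (hW : IsOpen W) {f : (Fin D → ℝ) → ℝ}
    (hf : ContDiffOn ℝ (⊤ : ℕ∞) f W) {x : Fin D → ℝ} (hx : x ∈ W) :
    DifferentiableAt ℝ f x :=
  (hf.differentiableOn (by simp)).differentiableAt (hW.mem_nhds hx)

theorem vfIter_succ_inner {D : ℕ} (a : (Fin D → ℝ) → (Fin D → ℝ)) (k : ℕ)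
    (f : (Fin D → ℝ) → ℝ) : vfIter a (k + 1) f = vfIter a k (vfDeriv a f) := by
  induction k with
  | zero => rfl
  | succ k ih =>
    change vfDeriv a (vfIter a (k + 1) f) = vfDeriv a (vfIter a k (vfDeriv a f))
    rw [ih]

theorem vfIter_congr {D : ℕ} (a : (Fin D → ℝ) → (Fin D → ℝ)) {W : Set (Fin D → ℝ)}
    (hW : IsOpen W) {f g : (Fin D → ℝ) → ℝ} (h : ∀ x ∈ W, f x = g x) (k : ℕ) :
    ∀ x ∈ W, vfIter a k f x = vfIter a k g x := by
  induction k with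
  | zero => exact h
  | succ k ih =>
    intro x hx
    have : vfIter a k f =ᶠ[𝓝 x] vfIter a k g := by
      filter_upwards [hW.mem_nhds hx] with y hy using ih y hy
    change fderiv ℝ _ x (a x) = fderiv ℝ _ x (a x)
    rw [this.fderiv_eq]

theorem vfIter_add {D : ℕ} {a : (Fin D → ℝ) → (Fin D → ℝ)} {W : Set (Fin D → ℝ)}
    (hW : IsOpen W) (ha : ContDiffOn ℝ (⊤ : ℕ∞) a W) (k : ℕ) :
    ∀ {f g : (Fin D → ℝ) → ℝ}, ContDiffOn ℝ (⊤ : ℕ∞) f W → ContDiffOn ℝ (⊤ : ℕ∞) g W →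
    ∀ x ∈ W, vfIter a k (fun y => f y + g y) x = vfIter a k f x + vfIter a k g x := by
  induction k with
  | zero => intro f g hf hg x hx; rfl
  | succ k ih =>
    intro f g hf hg x hx
    simp only [vfIter_succ_inner]
    rw [← ih (vfDeriv_smooth hW ha hf) (vfDeriv_smooth hW ha hg) x hx]
    refine vfIter_congr a hW ?_ k x hx
    intro y hy
    have := fderiv_fun_add (smooth_diffAt hW hf hy) (smooth_diffAt hW hg hy)
    simp [vfDeriv, this]

theorem vfIter_mul_zero {D : ℕ} {a : (Fin D → ℝ) → (Fin D → ℝ)} {W : Set (Fin D → ℝ)}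
    (hW : IsOpen W) (ha : ContDiffOn ℝ (⊤ : ℕ∞) a W) {x : Fin D → ℝ} (hx : x ∈ W) (k : ℕ) :
    ∀ {p q : (Fin D → ℝ) → ℝ}, ContDiffOn ℝ (⊤ : ℕ∞) p W → ContDiffOn ℝ (⊤ : ℕ∞) q W →
    (∀ i ≤ k, vfIter a i q x = 0) → vfIter a k (fun y => p y * q y) x = 0 := by
  induction k with
  | zero =>
    intro p q hp hq h
    have := h 0 le_rfl
    simp only [vfIter] at this ⊢
    rw [this, mul_zero]
  | succ k ih =>
    intro p q hp hq h
    have hp' := vfDeriv_smooth hW ha hp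
    have hq' := vfDeriv_smooth hW ha hq
    have e : ∀ y ∈ W, vfDeriv a (fun y => p y * q y) y
        = (fun y => p y * vfDeriv a q y + vfDeriv a p y * q y) y := by
      intro y hy
      have := fderiv_fun_mul (smooth_diffAt hW hp hy) (smooth_diffAt hW hq hy)
      simp [vfDeriv, this]
      ring
    rw [vfIter_succ_inner, vfIter_congr a hW e k x hx,
      vfIter_add hW ha k (hp.mul hq') (hp'.mul hq) x hx,
      ih hp hq' (fun i hi => by rw [← vfIter_succ_inner]; exact h _ (by omega)),
      ih hp' hq (fun i hi => h _ (by omega)), add_zero]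

/-- A function vanishing on a hypersurface `γ = 0` has vanishing iterated derivatives as soon as
`γ` does. -/
theorem vfIter_vanish {D : ℕ} {a : (Fin D → ℝ) → (Fin D → ℝ)} {W : Set (Fin D → ℝ)}
    (hW : IsOpen W) (ha : ContDiffOn ℝ (⊤ : ℕ∞) a W) {x : Fin D → ℝ} (hx : x ∈ W)
    {γ : (Fin D → ℝ) → ℝ} (hγ : ContDiffOn ℝ (⊤ : ℕ∞) γ W) (v : Fin D → ℝ)
    (hv : ∀ y ∈ W, fderiv ℝ γ y v ≠ 0) (k : ℕ) :
    ∀ {f : (Fin D → ℝ) → ℝ}, ContDiffOn ℝ (⊤ : ℕ∞) f W →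
    (∀ y ∈ W, γ y = 0 → f y = 0) →
    (∀ i ≤ k, vfIter a i γ x = 0) → vfIter a k f x = 0 := by
  induction k with
  | zero =>
    intro f hf h0 h
    exact h0 x hx (h 0 le_rfl)
  | succ k ih =>
    intro f hf h0 h
    have hdγ : ContDiffOn ℝ (⊤ : ℕ∞) (fun y => fderiv ℝ γ y v) W :=
      vfDeriv_smooth (a := fun _ => v) hW contDiffOn_const hγ
    have hdf : ContDiffOn ℝ (⊤ : ℕ∞) (fun y => fderiv ℝ f y v) W :=
      vfDeriv_smooth (a := fun _ => v) hW contDiffOn_const hf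
    have hg : ContDiffOn ℝ (⊤ : ℕ∞) (fun y => fderiv ℝ f y v / fderiv ℝ γ y v) W :=
      hdf.div hdγ hv
    set g : (Fin D → ℝ) → ℝ := fun y => fderiv ℝ f y v / fderiv ℝ γ y v with hgdef
    have hHγ := vfDeriv_smooth hW ha hγ
    have hHf := vfDeriv_smooth hW ha hf
    have hh : ContDiffOn ℝ (⊤ : ℕ∞) (fun y => vfDeriv a f y - g y * vfDeriv a γ y) W :=
      hHf.sub (hg.mul hHγ)
    have hz : ∀ y ∈ W, γ y = 0 → vfDeriv a f y - g y * vfDeriv a γ y = 0 := by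
      intro y hy hγy
      have hext : IsLocalExtrOn f {z | γ z = γ y} y := by
        left
        have : ∀ᶠ z in 𝓝[{z | γ z = γ y}] y, z ∈ W :=
          mem_nhdsWithin_of_mem_nhds (hW.mem_nhds hy)
        filter_upwards [this, self_mem_nhdsWithin] with z hz1 hz2
        have hz2' : γ z = 0 := by rw [← hγy]; exact hz2
        rw [h0 z hz1 hz2', h0 y hy hγy]
      have s1 : HasStrictFDerivAt γ (fderiv ℝ γ y) y :=
        (hγ.contDiffAt (hW.mem_nhds hy)).hasStrictFDerivAt (by simp)
      have s2 : HasStrictFDerivAt f (fderiv ℝ f y) y :=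
        (hf.contDiffAt (hW.mem_nhds hy)).hasStrictFDerivAt (by simp)
      obtain ⟨c, b, hcb, e⟩ := hext.exists_multipliers_of_hasStrictFDerivAt_1d s1 s2
      have ev : ∀ w, c * fderiv ℝ γ y w + b * fderiv ℝ f y w = 0 := by
        intro w
        have := DFunLike.congr_fun e w
        simpa using this
      have hvy := hv y hy
      have hb : b ≠ 0 := by
        rintro rfl
        have := ev v
        simp [hvy] at this
        simp [this] at hcb
      have e1 := ev v
      have e2 := ev (a y)
      simp only [vfDeriv, hgdef]
      field_simp
      apply mul_left_cancel₀ hb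
      linear_combination (fderiv ℝ γ y v) * e2 - (fderiv ℝ γ y (a y)) * e1
    have e : ∀ y ∈ W, vfDeriv a f y
        = (fun y => g y * vfDeriv a γ y + (vfDeriv a f y - g y * vfDeriv a γ y)) y := by
      intro y hy
      simp
    rw [vfIter_succ_inner, vfIter_congr a hW e k x hx,
      vfIter_add hW ha k (hg.mul hHγ) hh x hx,
      vfIter_mul_zero hW ha hx k hg hHγ
        (fun i hi => by rw [← vfIter_succ_inner]; exact h _ (by omega)),
      ih hh hz (fun i hi => h _ (by omega)), add_zero]

/-- Infinite order contact does not depend on the defining function. -/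
theorem contactInf_indep {D : ℕ} {a : (Fin D → ℝ) → (Fin D → ℝ)} {Ω S U : Set (Fin D → ℝ)}
    (ha : ContDiffOn ℝ (⊤ : ℕ∞) a Ω) {γ : (Fin D → ℝ) → ℝ} (hU : IsLocalDefining Ω S U γ)
    {x : Fin D → ℝ} (hx : x ∈ contactInf a Ω S) (hxU : x ∈ U) (k : ℕ) :
    vfIter a k γ x = 0 := by
  obtain ⟨hxS, U', γ', ⟨oU', sU', cγ', dγ', eU'⟩, hxU', hi⟩ := hx
  obtain ⟨oU, sU, cγ, dγ, eU⟩ := hU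
  obtain ⟨v, hv⟩ : ∃ v, fderiv ℝ γ' x v ≠ 0 := by
    by_contra! hcon
    exact dγ' x hxU' (ContinuousLinearMap.ext hcon)
  have hc : ContinuousOn (fun y => fderiv ℝ γ' y v) U' :=
    (vfDeriv_smooth (a := fun _ => v) oU' contDiffOn_const cγ').continuousOn
  have oV : IsOpen (U' ∩ (fun y => fderiv ℝ γ' y v) ⁻¹' {0}ᶜ) :=
    hc.isOpen_inter_preimage oU' isOpen_compl_singleton
  set W := U ∩ (U' ∩ (fun y => fderiv ℝ γ' y v) ⁻¹' {0}ᶜ) with hWdef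
  have oW : IsOpen W := oU.inter oV
  have hWU : W ⊆ U := fun y hy => hy.1
  have hWU' : W ⊆ U' := fun y hy => hy.2.1
  refine vfIter_vanish oW (ha.mono (hWU.trans sU)) ⟨hxU, hxU', hv⟩ (cγ'.mono hWU') v
    (fun y hy => hy.2.2) k (cγ.mono hWU) ?_ ?_
  · intro y hy h0
    have h1 : y ∈ S ∩ U' := by rw [eU']; exact ⟨hWU' hy, h0⟩
    have h2 : y ∈ S ∩ U := ⟨h1.1, hWU hy⟩
    rw [eU] at h2
    exact h2.2
  · intro i _
    rcases Nat.eq_zero_or_pos i with rfl | hpos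
    · have h1 : x ∈ S ∩ U' := ⟨hxS, hxU'⟩
      rw [eU'] at h1
      exact h1.2
    · exact hi i hpos

theorem contactInf_closed {D : ℕ} {a : (Fin D → ℝ) → (Fin D → ℝ)} {Ω S : Set (Fin D → ℝ)}
    (ha : ContDiffOn ℝ (⊤ : ℕ∞) a Ω) (hS : IsHypersurface Ω S) (hScl : closure S ∩ Ω ⊆ S) :
    closure (contactInf a Ω S) ∩ Ω ⊆ contactInf a Ω S := by
  rintro x ⟨hx, hxΩ⟩
  have hxS : x ∈ S := hScl ⟨closure_mono (fun y hy => hy.1) hx, hxΩ⟩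
  obtain ⟨U, γ, hU, hxU⟩ := hS.2 x hxS
  refine ⟨hxS, U, γ, hU, hxU, fun i _ => ?_⟩
  by_contra hne
  have hc : ContinuousOn (vfIter a i γ) U :=
    (vfIter_smooth hU.1 (ha.mono hU.2.1) hU.2.2.1 i).continuousOn
  have oV := hc.isOpen_inter_preimage hU.1 (isOpen_compl_singleton (x := (0 : ℝ)))
  obtain ⟨y, hy, hyC⟩ := mem_closure_iff.1 hx _ oV ⟨hxU, hne⟩
  exact hy.2 (contactInf_indep ha hU hyC hy.1 i)

/-- The set of points removed at a successor stage. -/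
def remSet {D : ℕ} (a : (Fin D → ℝ) → (Fin D → ℝ)) (Ω F : Set (Fin D → ℝ)) :
    Set (Fin D → ℝ) :=
  {x | ∃ U Θ, IsOpen U ∧ x ∈ U ∧ U ⊆ Ω ∧ IsHypersurface U Θ ∧
        F ∩ U ⊆ Θ ∧ ∃ k : ℕ, x ∈ contactSet a U Θ k}

theorem Fset_zero {D : ℕ} (a : (Fin D → ℝ) → (Fin D → ℝ)) (Ω S : Set (Fin D → ℝ)) :
    Fset a Ω S 0 = contactInf a Ω S := by
  unfold Fset
  rw [Ordinal.limitRecOn_zero]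

theorem Fset_succ {D : ℕ} (a : (Fin D → ℝ) → (Fin D → ℝ)) (Ω S : Set (Fin D → ℝ))
    (α : Ordinal) : Fset a Ω S (α + 1) = Fset a Ω S α \ remSet a Ω (Fset a Ω S α) := by
  unfold Fset
  rw [Ordinal.limitRecOn_add_one]
  rfl

theorem Fset_limit {D : ℕ} (a : (Fin D → ℝ) → (Fin D → ℝ)) (Ω S : Set (Fin D → ℝ))
    (α : Ordinal) (h : Order.IsSuccLimit α) :
    Fset a Ω S α = ⋂ (β) (_ : β < α), Fset a Ω S β := by
  unfold Fset
  rw [Ordinal.limitRecOn_limit _ _ _ _ h]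

theorem rem_closed {D : ℕ} {a : (Fin D → ℝ) → (Fin D → ℝ)} {Ω F : Set (Fin D → ℝ)}
    (ha : ContDiffOn ℝ (⊤ : ℕ∞) a Ω) (hF : closure F ∩ Ω ⊆ F) :
    closure (F \ remSet a Ω F) ∩ Ω ⊆ F \ remSet a Ω F := by
  rintro x ⟨hx, hxΩ⟩
  have hxF : x ∈ F := hF ⟨closure_mono Set.sdiff_subset hx, hxΩ⟩
  refine ⟨hxF, ?_⟩
  rintro ⟨U, Θ, oU, hxU, sU, hΘ, hsub, k, hxΘ, V, γ, hV, hxV, hz, hnz⟩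
  have hc : ContinuousOn (vfIter a (k + 1) γ) V :=
    (vfIter_smooth hV.1 (ha.mono (hV.2.1.trans sU)) hV.2.2.1 (k + 1)).continuousOn
  have oV := hc.isOpen_inter_preimage hV.1 (isOpen_compl_singleton (x := (0 : ℝ)))
  obtain ⟨y, hy, hyF, hyn⟩ := mem_closure_iff.1 hx _ oV ⟨hxV, hnz⟩
  apply hyn
  have hyU : y ∈ U := hV.2.1 hy.1
  have hyΘ : y ∈ Θ := hsub ⟨hyF, hyU⟩
  have hex : ∃ j, vfIter a (j + 1) γ y ≠ 0 := ⟨k, hy.2⟩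
  classical
  refine ⟨U, Θ, oU, hyU, sU, hΘ, hsub, Nat.find hex, hyΘ, V, γ, hV, hy.1, ?_,
    Nat.find_spec hex⟩
  intro i hi1 hi2
  have := Nat.find_min hex (m := i - 1) (by omega)
  rw [not_not, Nat.sub_add_cancel hi1] at this
  exact this

theorem Fset_closed {D : ℕ} {a : (Fin D → ℝ) → (Fin D → ℝ)} {Ω S : Set (Fin D → ℝ)}
    (ha : ContDiffOn ℝ (⊤ : ℕ∞) a Ω) (hS : IsHypersurface Ω S) (hScl : closure S ∩ Ω ⊆ S)
    (α : Ordinal) : closure (Fset a Ω S α) ∩ Ω ⊆ Fset a Ω S α := by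
  induction α using Ordinal.limitRecOn with
  | zero => rw [Fset_zero]; exact contactInf_closed ha hS hScl
  | add_one α ih => rw [Fset_succ]; exact rem_closed ha ih
  | limit α h ih =>
    rw [Fset_limit _ _ _ _ h]
    rintro x ⟨hx, hxΩ⟩
    simp only [Set.mem_iInter]
    intro β hβ
    exact ih β hβ ⟨closure_mono (Set.biInter_subset_of_mem (t := fun β => Fset a Ω S β) hβ) hx,
      hxΩ⟩

theorem Fset_anti {D : ℕ} (a : (Fin D → ℝ) → (Fin D → ℝ)) (Ω S : Set (Fin D → ℝ))
    (α : Ordinal) : ∀ β ≤ α, Fset a Ω S α ⊆ Fset a Ω S β := by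
  induction α using Ordinal.limitRecOn with
  | zero => intro β hβ; rw [le_antisymm hβ (zero_le)]
  | add_one α ih =>
    intro β hβ
    rcases hβ.eq_or_lt with rfl | hlt
    · exact subset_rfl
    · rw [Fset_succ]
      exact Set.sdiff_subset.trans (ih β (Order.lt_add_one_iff.1 hlt))
  | limit α h ih =>
    intro β hβ
    rcases hβ.eq_or_lt with rfl | hlt
    · exact subset_rfl
    · rw [Fset_limit _ _ _ _ h]
      exact Set.biInter_subset_of_mem (t := fun β => Fset a Ω S β) hlt

theorem exists_isolated {D : ℕ} {Ω E : Set (Fin D → ℝ)} (hΩ : IsOpen Ω) (hEΩ : E ⊆ Ω)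
    (hE : closure E ∩ Ω ⊆ E) (hc : E.Countable) (hne : E.Nonempty) :
    ∃ x ∈ E, ∃ U, IsOpen U ∧ x ∈ U ∧ E ∩ U ⊆ {x} := by
  have heq : closure E ∩ Ω = E := Set.Subset.antisymm hE (fun y hy => ⟨subset_closure hy, hEΩ hy⟩)
  have hlc : IsLocallyClosed E := by
    rw [← heq]
    exact isClosed_closure.isLocallyClosed.inter hΩ.isLocallyClosed
  have := hlc.locallyCompactSpace
  have : Countable E := hc.to_subtype
  have : Nonempty E := hne.to_subtype
  obtain ⟨x, y, hy⟩ := nonempty_interior_of_iUnion_of_closed (X := E) (f := fun x : E => {x})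
    (fun x => isClosed_singleton) (by ext; simp)
  have hyx : y = x := Set.mem_singleton_iff.1 (interior_subset hy)
  subst hyx
  obtain ⟨U, oU, hU⟩ := isOpen_induced_iff.1 (isOpen_interior (s := ({y} : Set E)))
  refine ⟨y, y.2, U, oU, ?_, ?_⟩
  · rw [← hU] at hy; exact hy
  · rintro z ⟨hzE, hzU⟩
    have : (⟨z, hzE⟩ : E) ∈ interior ({y} : Set E) := by rw [← hU]; exact hzU
    have h2 : (⟨z, hzE⟩ : E) = y := Set.mem_singleton_iff.1 (interior_subset this)
    simp [← h2]

theorem isolated_rem {D : ℕ} {a : (Fin D → ℝ) → (Fin D → ℝ)} {Ω E U : Set (Fin D → ℝ)}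
    (hΩ : IsOpen Ω) (ha0 : ∀ x ∈ Ω, a x ≠ 0) {x : Fin D → ℝ} (hxΩ : x ∈ Ω) (hU : IsOpen U)
    (hxU : x ∈ U) (hEU : E ∩ U ⊆ {x}) : x ∈ remSet a Ω E := by
  obtain ⟨j, hj⟩ : ∃ j, a x j ≠ 0 := Function.ne_iff.1 (ha0 x hxΩ)
  let L : (Fin D → ℝ) →L[ℝ] ℝ := ContinuousLinearMap.proj j
  have hfd : ∀ y, fderiv ℝ (fun y => L y - x j) y = L := by
    intro y
    rw [fderiv_sub_const, L.fderiv]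
  have hLD : IsLocalDefining (U ∩ Ω) {y ∈ U ∩ Ω | L y - x j = 0} (U ∩ Ω)
      (fun y => L y - x j) := by
    refine ⟨hU.inter hΩ, subset_rfl, (L.contDiff.sub contDiff_const).contDiffOn, ?_, ?_⟩
    · intro y _ h
      rw [hfd] at h
      exact hj (DFunLike.congr_fun h (a x))
    · ext y
      simp only [Set.mem_inter_iff, Set.mem_ofPred_eq]
      tauto
  have hxT : x ∈ {y ∈ U ∩ Ω | L y - x j = 0} := ⟨⟨hxU, hxΩ⟩, sub_self (x j)⟩
  refine ⟨U ∩ Ω, {y ∈ U ∩ Ω | L y - x j = 0}, hU.inter hΩ, ⟨hxU, hxΩ⟩, Set.inter_subset_right,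
    ⟨fun y hy => hy.1, fun y hy => ⟨_, _, hLD, hy.1⟩⟩, ?_, 0, hxT, _, _, hLD, ⟨hxU, hxΩ⟩, ?_, ?_⟩
  · rintro y ⟨hyE, hyU, _⟩
    have : y = x := hEU ⟨hyE, hyU⟩
    rw [this]
    exact hxT
  · intro i h1 h2
    omega
  · change fderiv ℝ (fun y => L y - x j) x (a x) ≠ 0
    rw [hfd]
    exact hj

universe uOrd

theorem Fset_aux
    {D : ℕ} (Ω S : Set (Fin D → ℝ)) (hΩ : IsOpen Ω)
    (a : (Fin D → ℝ) → (Fin D → ℝ)) (ha : ContDiffOn ℝ (⊤ : ℕ∞) a Ω)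
    (ha0 : ∀ x ∈ Ω, a x ≠ 0)
    (hS : IsHypersurface Ω S) (hScl : closure S ∩ Ω ⊆ S)
    (hcount : (contactInf a Ω S).Countable)
    (hne : ∀ α : Ordinal.{uOrd}, (Fset a Ω S α).Nonempty) : False := by
  have hΩ' : ∀ α : Ordinal.{uOrd}, Fset a Ω S α ⊆ Ω := fun α y hy => by
    have h1 := Fset_anti a Ω S α 0 (zero_le) hy
    rw [Fset_zero] at h1
    exact hS.1 h1.1
  have hstrict : ∀ α : Ordinal.{uOrd}, Fset a Ω S (α + 1) ≠ Fset a Ω S α := by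
    intro α h
    have hcα : (Fset a Ω S α).Countable := by
      refine hcount.mono ?_
      rw [← Fset_zero]
      exact Fset_anti a Ω S α 0 (zero_le)
    obtain ⟨x, hx, U, oU, hxU, hEU⟩ := exists_isolated hΩ (hΩ' α)
      (Fset_closed ha hS hScl α) hcα (hne α)
    have h2 := isolated_rem hΩ ha0 (hΩ' α hx) oU hxU hEU
    have h3 : x ∈ Fset a Ω S (α + 1) := by rw [h]; exact hx
    rw [Fset_succ] at h3
    exact h3.2 h2
  have key : ∀ α β : Ordinal.{uOrd}, α < β → Fset a Ω S α ≠ Fset a Ω S β := by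
    intro α β hlt he
    apply hstrict α
    apply Set.Subset.antisymm (Fset_anti a Ω S _ α (Order.le_succ α))
    rw [he]
    exact Fset_anti a Ω S β _ (Order.add_one_le_of_lt hlt)
  refine not_injective_of_ordinal (fun α : Ordinal.{uOrd} => Fset a Ω S α) ?_
  intro α β h
  rcases lt_trichotomy α β with hl | hl | hl
  · exact absurd h (key _ _ hl)
  · exact hl
  · exact absurd h.symm (key _ _ hl)

/-- Proposition 3.7, particular case: if `Σ(∞;H)` is finite or
countable, then `F(α;H;Σ) = ∅` for some ordinal `α`. -/
theorem Fset_empty_of_countable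
    {D : ℕ} (hD : 1 ≤ D) (Ω S : Set (Fin D → ℝ)) (hΩ : IsOpen Ω)
    (a : (Fin D → ℝ) → (Fin D → ℝ)) (ha : ContDiffOn ℝ (⊤ : ℕ∞) a Ω)
    (ha0 : ∀ x ∈ Ω, a x ≠ 0)
    (hS : IsHypersurface Ω S) (hScl : closure S ∩ Ω ⊆ S)
    (hcount : (contactInf a Ω S).Countable) :
    ∃ α : Ordinal, Fset a Ω S α = ∅ := by
  by_contra! hne
  exact Fset_aux Ω S hΩ a ha ha0 hS hScl hcount hne
end
end
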